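/- Factorisation of the star-Laplacian by discrete Cauchy–Riemann operators: Let h > 0 and let f : hℤ⁸ → 𝕆 be any octonion-valued lattice function. Define the conjugated discrete operators by (conj Dₕ⁻)f = ∂ₕ^{−0}f − Σ_{j=1}^{7} eⱼ(∂ₕ^{−j}f) and (conj Dₕ⁺)f = ∂ₕ^{+0}f − Σ_{j=1}^{7} eⱼ(∂ₕ^{+j}f), and the discrete star-Laplacian by Δₕf = Σ_{j=0}^{7} ∂ₕ^{+j}∂ₕ^{−j}f. Then Δₕf = ½ ( Dₕ⁺((conj Dₕ⁻)f) + Dₕ⁻((conj Dₕ⁺)f) ) at every lattice point. -/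

import Mathlib

open Quaternion

/-- The octonions `𝕆`, realised via the Cayley–Dickson doubling of the quaternions:
`𝕆 = ℍ × ℍ` with multiplication `(a,b)(c,d) = (ac - d̄b, da + bc̄)`. -/
def Octonion : Type := ℍ[ℝ] × ℍ[ℝ]

namespace Octonion

def ofPair (x : ℍ[ℝ] × ℍ[ℝ]) : Octonion := x
def toPair (x : Octonion) : ℍ[ℝ] × ℍ[ℝ] := x

noncomputable instance : NormedAddCommGroup Octonion :=
  inferInstanceAs (NormedAddCommGroup (ℍ[ℝ] × ℍ[ℝ]))

noncomputable instance : NormedSpace ℝ Octonion :=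
  inferInstanceAs (NormedSpace ℝ (ℍ[ℝ] × ℍ[ℝ]))

noncomputable instance : One Octonion := ⟨ofPair (1, 0)⟩

/-- Cayley–Dickson multiplication `(a,b)(c,d) = (ac - d̄b, da + bc̄)`.
It is non-associative but alternative, and reproduces the standard octonion
multiplication table for the basis `e` below (`e₄ = e₁e₂`, `e₅ = e₁e₃`,
`e₆ = e₂e₃`, `e₇ = (e₁e₂)e₃`, `eᵢ² = -1` for `i ≠ 0`, and `eᵢeⱼ = -eⱼeᵢ`
for distinct `i, j ∈ {1,…,7}`). -/
noncomputable instance : Mul Octonion :=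
  ⟨fun x y => ofPair
    ((toPair x).1 * (toPair y).1 - star (toPair y).2 * (toPair x).2,
     (toPair y).2 * (toPair x).1 + (toPair x).2 * star (toPair y).1)⟩

/-- The standard basis `e₀ = 1, e₁, …, e₇` of the octonions:
`e₀ = (1,0)`, `e₁ = (i,0)`, `e₂ = (j,0)`, `e₃ = (0,1)`, `e₄ = e₁e₂ = (k,0)`,
`e₅ = e₁e₃ = (0,i)`, `e₆ = e₂e₃ = (0,j)`, `e₇ = (e₁e₂)e₃ = (0,k)`. -/
noncomputable def e : Fin 8 → Octonion := fun i => ofPair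
  (![((1 : ℍ[ℝ]), (0 : ℍ[ℝ])),
     ((⟨0,1,0,0⟩ : ℍ[ℝ]), (0 : ℍ[ℝ])),
     ((⟨0,0,1,0⟩ : ℍ[ℝ]), (0 : ℍ[ℝ])),
     ((0 : ℍ[ℝ]), (1 : ℍ[ℝ])),
     ((⟨0,0,0,1⟩ : ℍ[ℝ]), (0 : ℍ[ℝ])),
     ((0 : ℍ[ℝ]), (⟨0,1,0,0⟩ : ℍ[ℝ])),
     ((0 : ℍ[ℝ]), (⟨0,0,1,0⟩ : ℍ[ℝ])),
     ((0 : ℍ[ℝ]), (⟨0,0,0,1⟩ : ℍ[ℝ]))] i)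

end Octonion

/-- Forward difference `∂ₕ^{+j} f(mh) = h⁻¹ (f(mh + hεⱼ) - f(mh))` of an
octonion-valued function on the lattice `hℤ⁸` (parametrised by `m ∈ ℤ⁸`). -/
noncomputable def fdiff (h : ℝ) (j : Fin 8) (f : (Fin 8 → ℤ) → Octonion)
    (m : Fin 8 → ℤ) : Octonion :=
  h⁻¹ • (f (m + Pi.single j 1) - f m)

/-- Backward difference `∂ₕ^{-j} f(mh) = h⁻¹ (f(mh) - f(mh - hεⱼ))`. -/
noncomputable def bdiff (h : ℝ) (j : Fin 8) (f : (Fin 8 → ℤ) → Octonion)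
    (m : Fin 8 → ℤ) : Octonion :=
  h⁻¹ • (f m - f (m - Pi.single j 1))

/-- Discrete forward Cauchy–Riemann operator `Dₕ⁺ f = Σⱼ eⱼ (∂ₕ^{+j} f)`. -/
noncomputable def Dplus (h : ℝ) (f : (Fin 8 → ℤ) → Octonion)
    (m : Fin 8 → ℤ) : Octonion :=
  ∑ j : Fin 8, Octonion.e j * fdiff h j f m

/-- Discrete backward Cauchy–Riemann operator `Dₕ⁻ f = Σⱼ eⱼ (∂ₕ^{-j} f)`. -/
noncomputable def Dminus (h : ℝ) (f : (Fin 8 → ℤ) → Octonion)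
    (m : Fin 8 → ℤ) : Octonion :=
  ∑ j : Fin 8, Octonion.e j * bdiff h j f m

/-- Right action of the discrete forward Cauchy–Riemann operator,
`g Dₕ⁺ = Σⱼ (∂ₕ^{+j} g) eⱼ`. -/
noncomputable def DplusRight (h : ℝ) (g : (Fin 8 → ℤ) → Octonion)
    (m : Fin 8 → ℤ) : Octonion :=
  ∑ j : Fin 8, fdiff h j g m * Octonion.e j

/-- Conjugated discrete backward Cauchy–Riemann operator
`(conj Dₕ⁻) f = ∂ₕ^{-0} f - Σ_{j=1}^{7} eⱼ (∂ₕ^{-j} f)`. -/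
noncomputable def DminusConj (h : ℝ) (f : (Fin 8 → ℤ) → Octonion)
    (m : Fin 8 → ℤ) : Octonion :=
  bdiff h 0 f m - ∑ j ∈ Finset.univ.erase (0 : Fin 8), Octonion.e j * bdiff h j f m

/-- Conjugated discrete forward Cauchy–Riemann operator
`(conj Dₕ⁺) f = ∂ₕ^{+0} f - Σ_{j=1}^{7} eⱼ (∂ₕ^{+j} f)`. -/
noncomputable def DplusConj (h : ℝ) (f : (Fin 8 → ℤ) → Octonion)
    (m : Fin 8 → ℤ) : Octonion :=
  fdiff h 0 f m - ∑ j ∈ Finset.univ.erase (0 : Fin 8), Octonion.e j * fdiff h j f m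

/-- The discrete star-Laplacian `Δₕ f = Σ_{j=0}^{7} ∂ₕ^{+j} ∂ₕ^{-j} f`. -/
noncomputable def starLaplacian (h : ℝ) (f : (Fin 8 → ℤ) → Octonion)
    (m : Fin 8 → ℤ) : Octonion :=
  ∑ j : Fin 8, fdiff h j (fun m' => bdiff h j f m') m

namespace Octonion

/-- Octonion conjugation, `conj (a, b) = (ā, -b)` in the Cayley–Dickson picture. -/
noncomputable def conj (x : Octonion) : Octonion :=
  ofPair (star (toPair x).1, -(toPair x).2)

/-- The Euclidean inner product on the octonions. -/
noncomputable def dot (x y : Octonion) : ℝ :=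
  (toPair x).1.re * (toPair y).1.re + (toPair x).1.imI * (toPair y).1.imI
    + (toPair x).1.imJ * (toPair y).1.imJ + (toPair x).1.imK * (toPair y).1.imK
    + (toPair x).2.re * (toPair y).2.re + (toPair x).2.imI * (toPair y).2.imI
    + (toPair x).2.imJ * (toPair y).2.imJ + (toPair x).2.imK * (toPair y).2.imK

theorem toPair_mul (x y : Octonion) : toPair (x * y) =
    ((toPair x).1 * (toPair y).1 - star (toPair y).2 * (toPair x).2,
     (toPair y).2 * (toPair x).1 + (toPair x).2 * star (toPair y).1) := rfl

theorem toPair_add (x y : Octonion) : toPair (x + y) = toPair x + toPair y := rfl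

theorem toPair_neg (x : Octonion) : toPair (-x) = -toPair x := rfl

theorem toPair_smul (r : ℝ) (x : Octonion) : toPair (r • x) = r • toPair x := rfl

theorem toPair_conj (x : Octonion) :
    toPair (conj x) = (star (toPair x).1, -(toPair x).2) := rfl

theorem toPair_injective : Function.Injective toPair := fun _ _ h => h

/-- Left multiplication by an octonion, as a real linear map. -/
noncomputable def mulLeft (a : Octonion) : Octonion →ₗ[ℝ] Octonion where
  toFun x := a * x
  map_add' x y := by
    apply toPair_injective
    simp only [toPair_mul, toPair_add, Prod.fst_add, Prod.snd_add, star_add, mul_add, add_mul,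
      Prod.mk_add_mk]
    ext1 <;> dsimp only <;> abel
  map_smul' r x := by
    apply toPair_injective
    simp [toPair_mul, toPair_smul, smul_sub, smul_add]

theorem mul_eq_mulLeft (a x : Octonion) : a * x = mulLeft a x := rfl

theorem neg_mul (a x : Octonion) : -a * x = -(a * x) := by
  apply toPair_injective
  simp only [toPair_mul, toPair_neg]
  ext1 <;> simp <;> abel

theorem mul_conj_mul_add_mul_conj_mul (a b x : Octonion) :
    a * (conj b * x) + b * (conj a * x) = (2 * dot a b) • x := by
  apply toPair_injective
  simp only [toPair_mul, toPair_add, toPair_smul, toPair_conj, dot]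
  obtain ⟨a₁, a₂⟩ := toPair a
  obtain ⟨b₁, b₂⟩ := toPair b
  obtain ⟨x₁, x₂⟩ := toPair x
  ext <;>
    simp only [Prod.mk_add_mk, Prod.smul_mk, Quaternion.re_add, Quaternion.imI_add,
      Quaternion.imJ_add, Quaternion.imK_add, Quaternion.re_sub, Quaternion.imI_sub,
      Quaternion.imJ_sub, Quaternion.imK_sub, Quaternion.re_neg, Quaternion.imI_neg,
      Quaternion.imJ_neg, Quaternion.imK_neg, Quaternion.re_mul, Quaternion.imI_mul,
      Quaternion.imJ_mul, Quaternion.imK_mul, Quaternion.re_star, Quaternion.imI_star,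
      Quaternion.imJ_star, Quaternion.imK_star, Quaternion.re_smul, Quaternion.imI_smul,
      Quaternion.imJ_smul, Quaternion.imK_smul, smul_eq_mul] <;>
    ring

theorem dot_e (j k : Fin 8) : dot (e j) (e k) = if j = k then 1 else 0 := by
  fin_cases j <;> fin_cases k <;> simp [dot, e, toPair, ofPair]

theorem conj_e_zero_mul (x : Octonion) : conj (e 0) * x = x := by
  have h0 : toPair (e 0) = (1, 0) := rfl
  apply toPair_injective
  simp [toPair_mul, toPair_conj, h0]

theorem conj_eq_neg_of_re_eq_zero {x : Octonion} (hx : (toPair x).1.re = 0) :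
    conj x = -x := by
  apply toPair_injective
  rw [toPair_conj, toPair_neg]
  ext <;> simp [hx]

theorem conj_e_of_ne_zero {k : Fin 8} (hk : k ≠ 0) : conj (e k) = -e k := by
  apply conj_eq_neg_of_re_eq_zero
  fin_cases k
  · exact absurd rfl hk
  all_goals simp [e, toPair, ofPair]

theorem sum_conj_e_mul (x : Fin 8 → Octonion) :
    ∑ k, conj (e k) * x k = x 0 - ∑ k ∈ Finset.univ.erase (0 : Fin 8), e k * x k := by
  rw [← Finset.add_sum_erase _ _ (Finset.mem_univ (0 : Fin 8)), conj_e_zero_mul, sub_eq_add_neg,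
    ← Finset.sum_neg_distrib]
  congr 1
  refine Finset.sum_congr rfl fun k hk => ?_
  rw [conj_e_of_ne_zero (Finset.ne_of_mem_erase hk), neg_mul]

end Octonion

open Octonion

theorem DminusConj_eq_sum (h : ℝ) (f : (Fin 8 → ℤ) → Octonion) (m : Fin 8 → ℤ) :
    DminusConj h f m = ∑ k, conj (e k) * bdiff h k f m :=
  (sum_conj_e_mul fun k => bdiff h k f m).symm

theorem DplusConj_eq_sum (h : ℝ) (f : (Fin 8 → ℤ) → Octonion) (m : Fin 8 → ℤ) :
    DplusConj h f m = ∑ k, conj (e k) * fdiff h k f m :=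
  (sum_conj_e_mul fun k => fdiff h k f m).symm

theorem fdiff_sum_mul (h : ℝ) (j : Fin 8) (c : Fin 8 → Octonion)
    (g : Fin 8 → (Fin 8 → ℤ) → Octonion) (m : Fin 8 → ℤ) :
    fdiff h j (fun m' => ∑ k, c k * g k m') m = ∑ k, c k * fdiff h j (g k) m := by
  simp only [fdiff, mul_eq_mulLeft, map_smul, map_sub, Finset.smul_sum, Finset.sum_sub_distrib,
    smul_sub]

theorem bdiff_sum_mul (h : ℝ) (j : Fin 8) (c : Fin 8 → Octonion)
    (g : Fin 8 → (Fin 8 → ℤ) → Octonion) (m : Fin 8 → ℤ) :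
    bdiff h j (fun m' => ∑ k, c k * g k m') m = ∑ k, c k * bdiff h j (g k) m := by
  simp only [bdiff, mul_eq_mulLeft, map_smul, map_sub, Finset.smul_sum, Finset.sum_sub_distrib,
    smul_sub]

theorem bdiff_fdiff_comm (h : ℝ) (j k : Fin 8) (f : (Fin 8 → ℤ) → Octonion) (m : Fin 8 → ℤ) :
    bdiff h k (fdiff h j f) m = fdiff h j (bdiff h k f) m := by
  simp only [bdiff, fdiff, ← smul_sub, sub_add_eq_add_sub]
  congr 2
  abel

theorem Dplus_DminusConj (h : ℝ) (f : (Fin 8 → ℤ) → Octonion) (m : Fin 8 → ℤ) :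
    Dplus h (DminusConj h f) m
      = ∑ j, ∑ k, e j * (conj (e k) * fdiff h j (bdiff h k f) m) := by
  rw [funext (DminusConj_eq_sum h f)]
  simp only [Dplus, fdiff_sum_mul]
  simp only [mul_eq_mulLeft (e _), map_sum]

theorem Dminus_DplusConj (h : ℝ) (f : (Fin 8 → ℤ) → Octonion) (m : Fin 8 → ℤ) :
    Dminus h (DplusConj h f) m
      = ∑ j, ∑ k, e k * (conj (e j) * fdiff h j (bdiff h k f) m) := by
  rw [funext (DplusConj_eq_sum h f), Finset.sum_comm]
  simp only [Dminus, bdiff_sum_mul, bdiff_fdiff_comm]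
  simp only [mul_eq_mulLeft (e _), map_sum]

/-- **Factorisation of the discrete star-Laplacian by the discrete
Cauchy–Riemann operators:** `Δₕ f = ½ (Dₕ⁺ ((conj Dₕ⁻) f) + Dₕ⁻ ((conj Dₕ⁺) f))`
at every lattice point. -/
theorem starLaplacian_factorisation (h : ℝ) (hh : 0 < h)
    (f : (Fin 8 → ℤ) → Octonion) (m : Fin 8 → ℤ) :
    starLaplacian h f m
      = (1 / 2 : ℝ) • (Dplus h (fun m' => DminusConj h f m') m
          + Dminus h (fun m' => DplusConj h f m') m) := by
  rw [Dplus_DminusConj, Dminus_DplusConj]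
  simp only [← Finset.sum_add_distrib, mul_conj_mul_add_mul_conj_mul, dot_e]
  simp [starLaplacian, ← Finset.smul_sum, smul_smul]
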